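/- The quotient ring Λ^{S₃}/(3, c₄, c₆) is isomorphic to the polynomial ring 𝔽₃[Δ̄] over the field with three elements, where Δ̄ is the class of Δ; in particular the classes of the powers Δ^k, k ≥ 0, form an 𝔽₃-basis of Λ^{S₃}/(3, c₄, c₆). -/

import Mathlib

open MvPolynomial

set_option synthInstance.maxHeartbeats 1000000
set_option maxHeartbeats 4000000

noncomputable section

/-- The ring ℤ[1/2], realized as the subring of ℚ generated by 1/2. -/
abbrev R2 : Type := Subring.closure {(2⁻¹ : ℚ)}

/-- Λ = ℤ[1/2][λ₁, λ₂], with λ₁ = X 0 and λ₂ = X 1. -/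
abbrev Lam : Type := MvPolynomial (Fin 2) R2

/-- A chosen 3-cycle σ₀ in S₃ = Perm (Fin 3). -/
def sig0 : Equiv.Perm (Fin 3) := finRotate 3

/-- A chosen transposition τ₀ in S₃ = Perm (Fin 3); note `tau0 * sig0 * tau0 = sig0 ^ 2`. -/
def tau0 : Equiv.Perm (Fin 3) := Equiv.swap 1 2

/-- c₄ = 16(λ₁² − λ₁λ₂ + λ₂²). -/
def cFour : Lam := 16 * (X 0 ^ 2 - X 0 * X 1 + X 1 ^ 2)

/-- c₆ = 32(λ₁ + λ₂)(2λ₁² − 5λ₁λ₂ + 2λ₂²). -/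
def cSix : Lam := 32 * (X 0 + X 1) * (2 * X 0 ^ 2 - 5 * X 0 * X 1 + 2 * X 1 ^ 2)

/-- Δ = 16λ₁²λ₂²(λ₁ − λ₂)². -/
def Del : Lam := 16 * X 0 ^ 2 * X 1 ^ 2 * (X 0 - X 1) ^ 2

/-- d = λ₁λ₂(λ₁ − λ₂). -/
def dE : Lam := X 0 * X 1 * (X 0 - X 1)

/-- The subalgebra Λ^{S₃} of invariants for an action ρ of S₃ on Λ by
ℤ[1/2]-algebra automorphisms. -/
def invS (ρ : Equiv.Perm (Fin 3) →* (Lam ≃ₐ[R2] Lam)) : Subalgebra R2 Lam where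
  carrier := {f | ∀ g, ρ g f = f}
  mul_mem' := fun hf hg g => by rw [map_mul, hf g, hg g]
  add_mem' := fun hf hg g => by rw [map_add, hf g, hg g]
  algebraMap_mem' := fun r g => by rw [AlgEquiv.commutes]

end
/-!
STATEMENT 11: Λ^{S₃}/(3, c₄, c₆) ≅ 𝔽₃[Δ̄], where Δ̄ is the class of Δ; in
particular the classes of the powers Δ^k form an 𝔽₃-basis of the quotient.
(Formalized as: there is a surjective ring homomorphism Λ^{S₃} → 𝔽₃[T] with
kernel exactly the ideal (3, c₄, c₆), sending Δ to T; equivalently the induced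
map Λ^{S₃}/(3, c₄, c₆) → 𝔽₃[T] is a ring isomorphism carrying Δ̄ to T.)
-/

/-- The ideal (3, c₄, c₆) of the invariant subring Λ^{S₃}. -/
noncomputable def Igen (ρ : Equiv.Perm (Fin 3) →* (Lam ≃ₐ[R2] Lam)) :
    Ideal (invS ρ) :=
  Ideal.span {a : invS ρ | (a : Lam) = 3 ∨ (a : Lam) = cFour ∨ (a : Lam) = cSix}

/-- The element `1/2` of `ℤ[1/2]`. -/
noncomputable def halfR2 : R2 := ⟨2⁻¹, Subring.subset_closure rfl⟩

lemma two_mul_halfR2 : (2 : R2) * halfR2 = 1 := by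
  apply Subtype.ext
  change (2 : ℚ) * 2⁻¹ = 1
  norm_num

lemma exists_two_pow_mul_eq_intCast (r : R2) : ∃ (k : ℕ) (n : ℤ), 2 ^ k * r = n := by
  suffices h : ∀ q ∈ Subring.closure {(2⁻¹ : ℚ)}, ∃ (k : ℕ) (n : ℤ), 2 ^ k * q = n by
    obtain ⟨k, n, hn⟩ := h r r.2
    exact ⟨k, n, Subtype.ext (by push_cast; exact hn)⟩
  intro q hq
  induction hq using Subring.closure_induction with
  | mem x hx => exact ⟨1, 1, by rw [Set.mem_singleton_iff.1 hx]; norm_num⟩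
  | zero => exact ⟨0, 0, by simp⟩
  | one => exact ⟨0, 1, by simp⟩
  | add x y _ _ hx hy =>
    obtain ⟨k, n, hk⟩ := hx
    obtain ⟨l, m, hl⟩ := hy
    exact ⟨k + l, 2 ^ l * n + 2 ^ k * m, by push_cast; rw [← hk, ← hl]; ring⟩
  | neg x _ hx =>
    obtain ⟨k, n, hk⟩ := hx
    exact ⟨k, -n, by push_cast; rw [← hk]; ring⟩
  | mul x y _ _ hx hy =>
    obtain ⟨k, n, hk⟩ := hx
    obtain ⟨l, m, hl⟩ := hy
    exact ⟨k + l, n * m, by push_cast; rw [← hk, ← hl]; ring⟩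

instance : IsLocalization.Away (2 : ℤ) R2 := by
  have hu : IsUnit (2 : R2) := IsUnit.of_mul_eq_one _ two_mul_halfR2
  refine ⟨?_, ?_, ?_⟩
  · rintro ⟨_, k, rfl⟩
    simpa using hu.pow k
  · intro r
    obtain ⟨k, n, h⟩ := exists_two_pow_mul_eq_intCast r
    exact ⟨⟨n, ⟨2 ^ k, k, rfl⟩⟩, by simpa [mul_comm] using h⟩
  · intro x y h
    refine ⟨1, ?_⟩
    simpa using h

/-- Reduction modulo three on `ℤ[1/2]`. -/
noncomputable def modThree : R2 →+* ZMod 3 :=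
  IsLocalization.Away.lift (2 : ℤ) (g := Int.castRingHom (ZMod 3))
    (IsUnit.of_mul_eq_one 2 (by decide))

lemma three_dvd_of_modThree_eq_zero {r : R2} (h : modThree r = 0) : ∃ s, r = 3 * s := by
  obtain ⟨k, n, hn⟩ := exists_two_pow_mul_eq_intCast r
  have h0 : ((n : ℤ) : ZMod 3) = 0 := by
    rw [← map_intCast modThree, ← hn, map_mul, h, mul_zero]
  obtain ⟨m, rfl⟩ := (ZMod.intCast_zmod_eq_zero_iff_dvd n 3).1 h0
  refine ⟨halfR2 ^ k * m, ?_⟩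
  have hk : (2 : R2) ^ k * halfR2 ^ k = 1 := by rw [← mul_pow, two_mul_halfR2, one_pow]
  push_cast at hn
  linear_combination halfR2 ^ k * hn - r * hk

lemma modThree_surjective : Function.Surjective modThree := fun x =>
  ⟨((x.val : ℕ) : R2), by rw [map_natCast, ZMod.natCast_val, ZMod.cast_id]⟩

/-- Restriction of a polynomial on the plane to the line `t ↦ (u t, v t)`. -/
noncomputable def restrictLine (u v : R2) : Lam →ₐ[R2] Polynomial R2 :=
  MvPolynomial.aeval ![Polynomial.C u * Polynomial.X, Polynomial.C v * Polynomial.X]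

@[simp] lemma restrictLine_X_zero (u v : R2) :
    restrictLine u v (X 0) = Polynomial.C u * Polynomial.X := by
  simp [restrictLine]

@[simp] lemma restrictLine_X_one (u v : R2) :
    restrictLine u v (X 1) = Polynomial.C v * Polynomial.X := by
  simp [restrictLine]

@[simp] lemma restrictLine_C (u v a : R2) :
    restrictLine u v (C a) = Polynomial.C a :=
  (restrictLine u v).commutes a

lemma coeff_zero_restrictLine (u v : R2) (f : Lam) :
    (restrictLine u v f).coeff 0 = constantCoeff f := by
  induction f using MvPolynomial.induction_on with
  | C a => simp
  | add p q hp hq => simp [hp, hq]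
  | mul_X p i _ => fin_cases i <;> simp

lemma coeff_one_restrictLine (u v : R2) (f : Lam) :
    (restrictLine u v f).coeff 1 =
      u * (restrictLine 1 0 f).coeff 1 + v * (restrictLine 0 1 f).coeff 1 := by
  have key (p : Polynomial R2) (w : R2) :
      (p * (Polynomial.C w * Polynomial.X)).coeff 1 = p.coeff 0 * w := by
    rw [← mul_assoc, show (1 : ℕ) = 0 + 1 from rfl, Polynomial.coeff_mul_X, Polynomial.coeff_mul_C]
  induction f using MvPolynomial.induction_on with
  | C a => simp
  | add p q hp hq => simp only [map_add, Polynomial.coeff_add, hp, hq]; ring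
  | mul_X p i _ =>
    fin_cases i <;>
    · simp only [Fin.zero_eta, Fin.mk_one, map_mul, restrictLine_X_zero, restrictLine_X_one, key,
        coeff_zero_restrictLine]
      ring

lemma X_one_dvd_sub_restrictLine (f : Lam) :
    (X 1 : Lam) ∣ f - Polynomial.aeval (X 0 : Lam) (restrictLine 1 0 f) := by
  induction f using MvPolynomial.induction_on with
  | C a => simp [MvPolynomial.algebraMap_eq]
  | add p q hp hq =>
    rw [map_add, map_add, add_sub_add_comm]
    exact dvd_add hp hq
  | mul_X p i hp =>
    fin_cases i
    · simpa [← sub_mul] using hp.mul_right (X 0)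
    · simp

lemma X_one_dvd_of_restrictLine_eq_zero {f : Lam} (h : restrictLine 1 0 f = 0) :
    (X 1 : Lam) ∣ f := by
  simpa [h] using X_one_dvd_sub_restrictLine f

lemma natDegree_restrictLine_le (f : Lam) :
    (restrictLine 1 0 f).natDegree ≤ f.totalDegree := by
  have := MvPolynomial.aeval_natDegree_le f (m := f.totalDegree) (n := 1) le_rfl
    ![Polynomial.C (1 : R2) * Polynomial.X, Polynomial.C (0 : R2) * Polynomial.X]
    (by intro i; fin_cases i <;> simp)
  simpa [restrictLine] using this

lemma totalDegree_cFour_le : cFour.totalDegree ≤ 2 := by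
  have h0 := isHomogeneous_X R2 (0 : Fin 2)
  have h1 := isHomogeneous_X R2 (1 : Fin 2)
  have h : cFour.IsHomogeneous (0 + 2) :=
    (isHomogeneous_C (Fin 2) (16 : R2)).mul (((h0.pow 2).sub (h0.mul h1)).add (h1.pow 2))
  exact h.totalDegree_le

lemma totalDegree_cSix_le : cSix.totalDegree ≤ 3 := by
  have h0 := isHomogeneous_X R2 (0 : Fin 2)
  have h1 := isHomogeneous_X R2 (1 : Fin 2)
  have hC := fun a : R2 => isHomogeneous_C (Fin 2) a
  have h : cSix.IsHomogeneous (0 + 1 + 2) :=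
    ((hC 32).mul (h0.add h1)).mul
      ((((hC 2).mul (h0.pow 2)).sub (((hC 5).mul h0).mul h1)).add ((hC 2).mul (h1.pow 2)))
  exact h.totalDegree_le

lemma restrictLine_cFour : restrictLine 1 0 cFour = 16 * Polynomial.X ^ 2 := by
  simp [cFour, map_ofNat (restrictLine 1 0) 16]

lemma restrictLine_cSix : restrictLine 1 0 cSix = 64 * Polynomial.X ^ 3 := by
  simp [cSix, map_ofNat (restrictLine 1 0) 32, map_ofNat (restrictLine 1 0) 2]
  ring

lemma dE_ne_zero : dE ≠ 0 := by
  intro h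
  have := congr_arg (eval ![2, 1]) h
  norm_num [dE] at this

lemma totalDegree_dE : dE.totalDegree = 3 := by
  have h0 := isHomogeneous_X R2 (0 : Fin 2)
  have h1 := isHomogeneous_X R2 (1 : Fin 2)
  exact ((h0.mul h1).mul (h0.sub h1) : dE.IsHomogeneous (1 + 1 + 1)).totalDegree dE_ne_zero

lemma Del_eq : Del = 16 * dE ^ 2 := by
  simp only [Del, dE]
  ring

section Invariants

variable {s t : Lam ≃ₐ[R2] Lam}

lemma restrictLine_comp (u v : R2) (f : Lam) (hs₁ : s (X 0) = X 1 - X 0)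
    (hs₂ : s (X 1) = -X 0) : restrictLine u v (s f) = restrictLine (v - u) (-u) f := by
  have : (restrictLine u v).comp s.toAlgHom = restrictLine (v - u) (-u) := by
    ext i : 1
    fin_cases i
    · simp [hs₁, sub_mul]
    · simp only [Fin.mk_one, AlgHom.comp_apply, AlgEquiv.toAlgHom_apply, hs₂, map_neg,
        restrictLine_X_zero, restrictLine_X_one]
      ring
  exact DFunLike.congr_fun this f

lemma restrictLine_swap (u v : R2) (f : Lam) (ht₁ : t (X 0) = X 1)
    (ht₂ : t (X 1) = X 0) : restrictLine u v (t f) = restrictLine v u f := by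
  have : (restrictLine u v).comp t.toAlgHom = restrictLine v u := by
    ext i : 1
    fin_cases i <;> simp [ht₁, ht₂]
  exact DFunLike.congr_fun this f

lemma coeff_one_restrictLine_eq_zero {f : Lam} (hs₁ : s (X 0) = X 1 - X 0)
    (hs₂ : s (X 1) = -X 0) (hs : s f = f) : (restrictLine 1 0 f).coeff 1 = 0 := by
  have h₁ := congr_arg (Polynomial.coeff · 1) (restrictLine_comp 1 0 f hs₁ hs₂)
  have h₂ := congr_arg (Polynomial.coeff · 1) (restrictLine_comp 0 1 f hs₁ hs₂)
  simp only [hs, sub_zero, zero_sub, neg_zero] at h₁ h₂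
  rw [coeff_one_restrictLine (-1) (-1)] at h₁
  have h : (3 : R2) * (restrictLine 1 0 f).coeff 1 = 0 := by linear_combination h₁ - h₂
  exact (mul_eq_zero.1 h).resolve_left (by norm_num)

lemma dE_dvd {f : Lam} (hs₁ : s (X 0) = X 1 - X 0) (hs₂ : s (X 1) = -X 0) (hs : s f = f)
    (h : restrictLine 1 0 f = 0) : dE ∣ f := by
  have h1 := X_one_dvd_of_restrictLine_eq_zero h
  have h0 : (X 0 : Lam) ∣ f := by
    have := map_dvd s h1
    rw [hs, hs₂] at this
    obtain ⟨c, hc⟩ := this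
    exact ⟨-c, by linear_combination hc⟩
  have h01 : (X 1 - X 0 : Lam) ∣ f := by
    have := map_dvd s h0
    rwa [hs, hs₁] at this
  have p0 : Prime (X 0 : Lam) := MvPolynomial.X_prime
  have p01 : Prime (X 1 - X 0 : Lam) := hs₁ ▸ (MulEquiv.prime_iff s.toMulEquiv).2 p0
  have not_dvd {p q : Lam} (a : Fin 2 → R2) (hp : eval a p = 0) (hq : eval a q = 1) :
      ¬ p ∣ q := fun hpq => by
    have := map_dvd (eval a) hpq
    rw [hp, hq, zero_dvd_iff] at this
    exact one_ne_zero this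
  obtain ⟨g, rfl⟩ := h1
  obtain ⟨k, rfl⟩ := (p0.dvd_or_dvd h0).resolve_left (not_dvd ![0, 1] (by simp) (by simp))
  obtain ⟨l, rfl⟩ := ((p01.dvd_or_dvd h01).resolve_left
    (not_dvd ![1, 1] (by simp) (by simp)) |> p01.dvd_or_dvd).resolve_left
    (not_dvd ![1, 1] (by simp) (by simp))
  exact ⟨-l, by simp only [dE]; ring⟩

lemma map_dE_sigma (hs₁ : s (X 0) = X 1 - X 0) (hs₂ : s (X 1) = -X 0) : s dE = dE := by
  simp only [dE, map_mul, map_sub, hs₁, hs₂]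
  ring

lemma map_dE_tau (ht₁ : t (X 0) = X 1) (ht₂ : t (X 1) = X 0) : t dE = -dE := by
  simp only [dE, map_mul, map_sub, ht₁, ht₂]
  ring

lemma exists_eq_Del_mul {f : Lam} (hs₁ : s (X 0) = X 1 - X 0) (hs₂ : s (X 1) = -X 0)
    (ht₁ : t (X 0) = X 1) (ht₂ : t (X 1) = X 0) (hs : s f = f) (ht : t f = f)
    (h : restrictLine 1 0 f = 0) :
    ∃ k : Lam, f = Del * k ∧ s k = k ∧ t k = k ∧ (f ≠ 0 → k.totalDegree < f.totalDegree) := by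
  have hd := dE_ne_zero
  have hds := map_dE_sigma hs₁ hs₂
  have hdt := map_dE_tau ht₁ ht₂
  obtain ⟨g, rfl⟩ := dE_dvd hs₁ hs₂ hs h
  have hgs : s g = g := mul_left_cancel₀ hd (by rwa [map_mul, hds] at hs)
  have hgt : t g = -g := mul_left_cancel₀ hd (by
    rw [map_mul, hdt] at ht
    linear_combination -ht)
  have hg : restrictLine 1 0 g = 0 := by
    have h₁ := restrictLine_comp 0 1 g hs₁ hs₂
    have h₂ := restrictLine_swap 1 0 g ht₁ ht₂
    simp only [hgs, hgt, map_neg, sub_zero, neg_zero] at h₁ h₂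
    have h₃ : (2 : Polynomial R2) * restrictLine 1 0 g = 0 := by linear_combination -h₁ - h₂
    exact (mul_eq_zero.1 h₃).resolve_left (by norm_num)
  obtain ⟨k, rfl⟩ := dE_dvd hs₁ hs₂ hgs hg
  have hks : s k = k := mul_left_cancel₀ hd (by rwa [map_mul, hds] at hgs)
  have hkt : t k = k := mul_left_cancel₀ hd (by
    rw [map_mul, hdt] at hgt
    linear_combination -hgt)
  have hc : (16 : Lam) * C (halfR2 ^ 4) = 1 := by
    have h16 : (16 : R2) * halfR2 ^ 4 = 1 := by
      linear_combination (8 * halfR2 ^ 3 + 4 * halfR2 ^ 2 + 2 * halfR2 + 1) * two_mul_halfR2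
    have := congr_arg (C : R2 → Lam) h16
    rwa [C_mul, C_1] at this
  refine ⟨C (halfR2 ^ 4) * k, ?_, ?_, ?_, fun hf => ?_⟩
  · rw [Del_eq]
    linear_combination -(dE ^ 2 * k) * hc
  · rw [map_mul, hks, ← algebraMap_eq, AlgEquiv.commutes]
  · rw [map_mul, hkt, ← algebraMap_eq, AlgEquiv.commutes]
  · have hk : k ≠ 0 := by rintro rfl; simp at hf
    have hle : (C (halfR2 ^ 4) * k).totalDegree ≤ k.totalDegree := by
      rw [C_mul']
      exact totalDegree_smul_le _ k
    rw [totalDegree_mul_of_isDomain hd (mul_ne_zero hd hk), totalDegree_mul_of_isDomain hd hk,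
      totalDegree_dE]
    omega

end Invariants

section Quotient

variable {ρ : Equiv.Perm (Fin 3) →* (Lam ≃ₐ[R2] Lam)}

lemma mem_invS_of_generators {f : Lam} (hs : ρ sig0 f = f) (ht : ρ tau0 f = f) :
    f ∈ invS ρ := by
  have hgen : ∀ g : Equiv.Perm (Fin 3), ∃ (i : Fin 3) (j : Fin 2),
      g = sig0 ^ (i : ℕ) * tau0 ^ (j : ℕ) := by decide
  have hpow {e : Lam ≃ₐ[R2] Lam} (he : e f = f) (n : ℕ) : (e ^ n) f = f := by
    induction n with
    | zero => rfl
    | succ n ih => rw [pow_succ, AlgEquiv.mul_apply, he, ih]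
  intro g
  obtain ⟨i, j, rfl⟩ := hgen g
  rw [map_mul, map_pow, map_pow, AlgEquiv.mul_apply, hpow ht, hpow hs]

lemma three_mem_Igen : (3 : invS ρ) ∈ Igen ρ := Ideal.subset_span (Or.inl rfl)

lemma exists_mem_Igen_restrictLine_eq_X_pow (h₄ : cFour ∈ invS ρ) (h₆ : cSix ∈ invS ρ)
    (n : ℕ) : ∃ m : invS ρ, m ∈ Igen ρ ∧ restrictLine 1 0 m = Polynomial.X ^ (n + 2) ∧
      (m : Lam).totalDegree ≤ n + 2 := by
  have hC : Polynomial.C halfR2 * 2 = 1 := by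
    have := congr_arg Polynomial.C two_mul_halfR2
    rwa [Polynomial.C_mul, Polynomial.C_1, mul_comm] at this
  have hsmul (r : R2) (m : Lam) : (r • m).totalDegree ≤ m.totalDegree := totalDegree_smul_le r m
  induction n using Nat.twoStepInduction with
  | zero =>
    refine ⟨halfR2 ^ 4 • ⟨cFour, h₄⟩, ?_, ?_, (hsmul _ _).trans totalDegree_cFour_le⟩
    · exact Submodule.smul_of_tower_mem _ _ (Ideal.subset_span (Or.inr (Or.inl rfl)))
    · change restrictLine 1 0 (halfR2 ^ 4 • cFour) = _
      rw [map_smul, restrictLine_cFour, Polynomial.smul_eq_C_mul, map_pow]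
      linear_combination (8 * Polynomial.C halfR2 ^ 3 + 4 * Polynomial.C halfR2 ^ 2 +
        2 * Polynomial.C halfR2 + 1) * Polynomial.X ^ 2 * hC
  | one =>
    refine ⟨halfR2 ^ 6 • ⟨cSix, h₆⟩, ?_, ?_, (hsmul _ _).trans totalDegree_cSix_le⟩
    · exact Submodule.smul_of_tower_mem _ _ (Ideal.subset_span (Or.inr (Or.inr rfl)))
    · change restrictLine 1 0 (halfR2 ^ 6 • cSix) = _
      rw [map_smul, restrictLine_cSix, Polynomial.smul_eq_C_mul, map_pow]
      linear_combination (32 * Polynomial.C halfR2 ^ 5 + 16 * Polynomial.C halfR2 ^ 4 +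
        8 * Polynomial.C halfR2 ^ 3 + 4 * Polynomial.C halfR2 ^ 2 +
        2 * Polynomial.C halfR2 + 1) * Polynomial.X ^ 3 * hC
  | more n ih _ =>
    obtain ⟨m, hm, hr, hd⟩ := ih
    refine ⟨halfR2 ^ 4 • ⟨cFour, h₄⟩ * m, Ideal.mul_mem_left _ _ hm, ?_, ?_⟩
    · change restrictLine 1 0 (halfR2 ^ 4 • cFour * m) = _
      rw [map_mul, map_smul, restrictLine_cFour, Polynomial.smul_eq_C_mul, map_pow, hr]
      linear_combination (8 * Polynomial.C halfR2 ^ 3 + 4 * Polynomial.C halfR2 ^ 2 +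
        2 * Polynomial.C halfR2 + 1) * Polynomial.X ^ (n + 4) * hC
    · change (halfR2 ^ 4 • cFour * (m : Lam)).totalDegree ≤ _
      refine (totalDegree_mul _ _).trans ?_
      have := (hsmul (halfR2 ^ 4) cFour).trans totalDegree_cFour_le
      omega

/-- A polynomial in one variable without linear term is the restriction of a scalar plus an
element of `(3, c₄, c₆)`, without increase of the degree. -/
lemma exists_mem_Igen_restrictLine_eq (h₄ : cFour ∈ invS ρ) (h₆ : cSix ∈ invS ρ)
    (q : Polynomial R2) (hq : q.coeff 1 = 0) :
    ∃ m : invS ρ, m ∈ Igen ρ ∧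
      restrictLine 1 0 ((m : Lam) + C (q.coeff 0)) = q ∧ (m : Lam).totalDegree ≤ q.natDegree := by
  choose m hm hr hd using exists_mem_Igen_restrictLine_eq_X_pow h₄ h₆
  refine ⟨∑ i ∈ Finset.range (q.natDegree - 1), q.coeff (i + 2) • m i,
    Ideal.sum_mem _ fun i _ => Submodule.smul_of_tower_mem _ _ (hm i), ?_, ?_⟩
  · have hq' : q = ∑ i ∈ Finset.range (q.natDegree - 1 + 2),
        Polynomial.C (q.coeff i) * Polynomial.X ^ i :=
      q.as_sum_range_C_mul_X_pow' (by omega)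
    conv_rhs => rw [hq', Finset.sum_range_succ', Finset.sum_range_succ']
    simp [hq, hr, Polynomial.smul_eq_C_mul]
  · rw [AddSubmonoidClass.coe_finsetSum]
    refine totalDegree_finsetSum_le fun i hi => ?_
    have := Finset.mem_range.1 hi
    exact (totalDegree_smul_le _ _).trans ((hd i).trans (by omega))

/-- Modulo `(3, c₄, c₆)` every invariant is a polynomial in the discriminant. -/
lemma exists_sub_aeval_mem_Igen (hσ₁ : ρ sig0 (X 0) = X 1 - X 0) (hσ₂ : ρ sig0 (X 1) = - X 0)
    (hτ₁ : ρ tau0 (X 0) = X 1) (hτ₂ : ρ tau0 (X 1) = X 0)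
    (h₄ : cFour ∈ invS ρ) (h₆ : cSix ∈ invS ρ) (hΔ : Del ∈ invS ρ) (f : invS ρ) :
    ∃ p : Polynomial R2, f - Polynomial.aeval (⟨Del, hΔ⟩ : invS ρ) p ∈ Igen ρ := by
  induction hn : (f : Lam).totalDegree using Nat.strong_induction_on generalizing f with
  | _ n ih =>
  obtain ⟨m, hm, hr, hd⟩ := exists_mem_Igen_restrictLine_eq h₄ h₆ (restrictLine 1 0 f)
    (coeff_one_restrictLine_eq_zero hσ₁ hσ₂ (f.2 sig0))
  set a := (restrictLine 1 0 f).coeff 0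
  set g : invS ρ := f - (m + algebraMap R2 (invS ρ) a) with hg
  have hgf : (g : Lam) = (f : Lam) - ((m : Lam) + C a) := rfl
  obtain ⟨k, hk, hks, hkt, hkd⟩ := exists_eq_Del_mul hσ₁ hσ₂ hτ₁ hτ₂ (g.2 sig0) (g.2 tau0)
    (by rw [hgf, map_sub, hr, sub_self])
  by_cases hg0 : g = 0
  · refine ⟨Polynomial.C a, ?_⟩
    have : f - Polynomial.aeval (⟨Del, hΔ⟩ : invS ρ) (Polynomial.C a) = m := by
      rw [Polynomial.aeval_C]
      linear_combination hg0
    rwa [this]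
  · have hlt : k.totalDegree < n := by
      refine (hkd fun h => hg0 (Subtype.ext h)).trans_le ?_
      have h₁ : ((m : Lam) + C a).totalDegree ≤ (f : Lam).totalDegree :=
        (totalDegree_add _ _).trans
          (max_le (hd.trans (natDegree_restrictLine_le _)) (by simp))
      rw [hgf, ← hn]
      exact (totalDegree_sub _ _).trans (max_le le_rfl h₁)
    obtain ⟨p, hp⟩ := ih _ hlt ⟨k, mem_invS_of_generators hks hkt⟩ rfl
    refine ⟨Polynomial.C a + Polynomial.X * p, ?_⟩
    have hgk : g = ⟨Del, hΔ⟩ * ⟨k, mem_invS_of_generators hks hkt⟩ := Subtype.ext hk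
    convert add_mem hm (Ideal.mul_mem_left _ (⟨Del, hΔ⟩ : invS ρ) hp) using 1
    rw [map_add, map_mul, Polynomial.aeval_C, Polynomial.aeval_X]
    linear_combination hgk

lemma aeval_mem_Igen {p : Polynomial R2} (hp : p.map modThree = 0) (x : invS ρ) :
    Polynomial.aeval x p ∈ Igen ρ := by
  rw [Polynomial.aeval_eq_sum_range]
  refine Ideal.sum_mem _ fun i _ => ?_
  have hi : modThree (p.coeff i) = 0 := by rw [← Polynomial.coeff_map, hp, Polynomial.coeff_zero]
  obtain ⟨s, hs⟩ := three_dvd_of_modThree_eq_zero hi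
  rw [hs, Algebra.smul_def, map_mul, map_ofNat, mul_assoc]
  exact Ideal.mul_mem_right _ _ three_mem_Igen

end Quotient

/-- Reduction modulo three followed by restriction to the line `λ₁ + λ₂ = 0`. -/
noncomputable def cuspidalReduction : Lam →+* Polynomial (ZMod 3) :=
  (Polynomial.mapRingHom modThree).comp (restrictLine 1 (-1)).toRingHom

lemma cuspidalReduction_apply (f : Lam) :
    cuspidalReduction f = (restrictLine 1 (-1) f).map modThree := rfl

lemma cuspidalReduction_cFour : cuspidalReduction cFour = 0 := by
  have : restrictLine 1 (-1) cFour = Polynomial.C 3 * (16 * Polynomial.X ^ 2) := by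
    simp only [cFour, map_mul, map_add, map_sub, map_pow, map_ofNat (restrictLine 1 (-1)) 16,
      restrictLine_X_zero, restrictLine_X_one, Polynomial.C_1, Polynomial.C_neg,
      Polynomial.C_ofNat]
    ring
  rw [cuspidalReduction_apply, this, Polynomial.map_mul, Polynomial.map_C, map_ofNat,
    show (3 : ZMod 3) = 0 from rfl, Polynomial.C_0, zero_mul]

lemma cuspidalReduction_cSix : cuspidalReduction cSix = 0 := by
  simp [cuspidalReduction_apply, cSix]

lemma cuspidalReduction_Del : cuspidalReduction Del = Polynomial.X ^ 6 := by
  have : restrictLine 1 (-1) Del = Polynomial.C 64 * Polynomial.X ^ 6 := by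
    simp only [Del, map_mul, map_sub, map_pow, map_ofNat (restrictLine 1 (-1)) 16,
      restrictLine_X_zero, restrictLine_X_one, Polynomial.C_1, Polynomial.C_neg,
      Polynomial.C_ofNat]
    ring
  rw [cuspidalReduction_apply, this, Polynomial.map_mul, Polynomial.map_C, map_ofNat,
    show (64 : ZMod 3) = 1 from rfl, Polynomial.C_1, one_mul, Polynomial.map_pow, Polynomial.map_X]

lemma cuspidalReduction_eq_zero_of_mem_Igen {ρ : Equiv.Perm (Fin 3) →* (Lam ≃ₐ[R2] Lam)}
    {x : invS ρ} (hx : x ∈ Igen ρ) : cuspidalReduction x = 0 := by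
  have : Igen ρ ≤ RingHom.ker (cuspidalReduction.comp (invS ρ).val.toRingHom) := by
    refine Ideal.span_le.2 fun a ha => ?_
    change cuspidalReduction (a : Lam) = 0
    rcases ha with h | h | h
    · rw [h, map_ofNat, ← Polynomial.C_ofNat, show (3 : ZMod 3) = 0 from rfl, Polynomial.C_0]
    · rw [h, cuspidalReduction_cFour]
    · rw [h, cuspidalReduction_cSix]
  exact this hx

lemma cuspidalReduction_aeval_Del {ρ : Equiv.Perm (Fin 3) →* (Lam ≃ₐ[R2] Lam)}
    (hΔ : Del ∈ invS ρ) (p : Polynomial R2) :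
    cuspidalReduction (Polynomial.aeval (⟨Del, hΔ⟩ : invS ρ) p : invS ρ) =
      Polynomial.expand (ZMod 3) 6 (p.map modThree) := by
  have hC (a : R2) : cuspidalReduction (C a) = Polynomial.C (modThree a) := by
    rw [cuspidalReduction_apply, restrictLine_C, Polynomial.map_C]
  induction p using Polynomial.induction_on' with
  | add p q hp hq => simp only [map_add, Subalgebra.coe_add, hp, hq, Polynomial.map_add]
  | monomial n a =>
    rw [Polynomial.aeval_monomial, Polynomial.map_monomial, Polynomial.expand_monomial]
    change cuspidalReduction (C a * Del ^ n) = _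
    rw [map_mul, map_pow, hC, cuspidalReduction_Del, ← pow_mul, ← Polynomial.C_mul_X_pow_eq_monomial,
      mul_comm n]

theorem statement11 (ρ : Equiv.Perm (Fin 3) →* (Lam ≃ₐ[R2] Lam))
    (hσ₁ : ρ sig0 (X 0) = X 1 - X 0) (hσ₂ : ρ sig0 (X 1) = - X 0)
    (hτ₁ : ρ tau0 (X 0) = X 1) (hτ₂ : ρ tau0 (X 1) = X 0) :
    ∃ φ : (invS ρ) →+* Polynomial (ZMod 3),
      Function.Surjective φ ∧
      (∀ x : invS ρ, φ x = 0 ↔ x ∈ Igen ρ) ∧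
      (∀ x : invS ρ, (x : Lam) = Del → φ x = Polynomial.X) := by
  have h₄ : cFour ∈ invS ρ := mem_invS_of_generators
    (by simp only [cFour, map_mul, map_add, map_sub, map_pow, map_ofNat, hσ₁, hσ₂]; ring)
    (by simp only [cFour, map_mul, map_add, map_sub, map_pow, map_ofNat, hτ₁, hτ₂]; ring)
  have h₆ : cSix ∈ invS ρ := mem_invS_of_generators
    (by simp only [cSix, map_mul, map_add, map_sub, map_pow, map_ofNat, hσ₁, hσ₂]; ring)
    (by simp only [cSix, map_mul, map_add, map_sub, map_pow, map_ofNat, hτ₁, hτ₂]; ring)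
  have hΔ : Del ∈ invS ρ := mem_invS_of_generators
    (by simp only [Del, map_mul, map_sub, map_pow, map_ofNat, hσ₁, hσ₂]; ring)
    (by simp only [Del, map_mul, map_sub, map_pow, map_ofNat, hτ₁, hτ₂]; ring)
  have hnormal := exists_sub_aeval_mem_Igen hσ₁ hσ₂ hτ₁ hτ₂ h₄ h₆ hΔ
  have hred {f : invS ρ} {p : Polynomial R2}
      (h : f - Polynomial.aeval (⟨Del, hΔ⟩ : invS ρ) p ∈ Igen ρ) :
      cuspidalReduction f = Polynomial.expand (ZMod 3) 6 (p.map modThree) := by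
    have h0 := cuspidalReduction_eq_zero_of_mem_Igen h
    rw [Subalgebra.coe_sub, map_sub, sub_eq_zero] at h0
    rw [h0, cuspidalReduction_aeval_Del hΔ]
  have hinj := Polynomial.expand_injective (R := ZMod 3) (n := 6) (by norm_num)
  let e := AlgEquiv.ofInjective (Polynomial.expand (ZMod 3) 6) hinj
  let ψ : invS ρ →+* (Polynomial.expand (ZMod 3) 6).range :=
    (cuspidalReduction.comp (invS ρ).val.toRingHom).codRestrict _ fun f => by
      obtain ⟨p, hp⟩ := hnormal f
      exact ⟨_, (hred hp).symm⟩
  let φ : invS ρ →+* Polynomial (ZMod 3) := e.symm.toRingEquiv.toRingHom.comp ψ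
  have hφ (f : invS ρ) : Polynomial.expand (ZMod 3) 6 (φ f) = cuspidalReduction f :=
    congr_arg Subtype.val (e.apply_symm_apply (ψ f))
  refine ⟨φ, fun q => ?_, fun x => ⟨fun h => ?_, fun h => ?_⟩, fun x hx => ?_⟩
  · obtain ⟨p, rfl⟩ := Polynomial.map_surjective modThree modThree_surjective q
    exact ⟨_, hinj ((hφ _).trans (cuspidalReduction_aeval_Del hΔ p))⟩
  · obtain ⟨p, hp⟩ := hnormal x
    have hp0 : p.map modThree = 0 :=
      hinj (by rw [← hred hp, ← hφ, h])
    convert add_mem hp (aeval_mem_Igen hp0 (⟨Del, hΔ⟩ : invS ρ)) using 1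
    ring
  · exact hinj (by rw [hφ, cuspidalReduction_eq_zero_of_mem_Igen h, map_zero])
  · exact hinj (by rw [hφ, hx, cuspidalReduction_Del, Polynomial.expand_X])
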